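/- Suppose H : closure(Ω) × ℝ² → ℝ is continuous, C¹ in W with jointly continuous gradient, H ≥ 0, and satisfies (H₃): 0 < 2θ_max H(x,W) ≤ W·∇H(x,W) for all x ∈ closure(Ω) and all W ≠ (0,0); moreover there exist ξ > 2θ_max, C₁ > 0 and C₂ ≥ 0 with H(x,W) ≥ C₁ |W|^ξ − C₂ for all x ∈ closure(Ω), W ∈ ℝ². Fix a pair Φ = (φ, ψ) of smooth, nonnegative functions with compact support in Ω, not both identically zero. Then for each λ > 0 the quantity M(λ) := sup_{t ≥ 0} J_λ(tΦ) satisfies 0 ≤ M(λ) < ∞, and M(λ) → 0 as λ → +∞. -/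

import Mathlib

open MeasureTheory Real Filter

noncomputable def gnorm (Ω : Set (ℝ × ℝ)) (u : (ℝ × ℝ) → ℝ) : ℝ :=
  Real.sqrt (∫ x in Ω, ‖fderiv ℝ u x‖ ^ 2)

noncomputable def pnorm (Ω : Set (ℝ × ℝ)) (u v : (ℝ × ℝ) → ℝ) : ℝ :=
  Real.sqrt ((gnorm Ω u) ^ 2 + (gnorm Ω v) ^ 2)

def IsTest (Ω : Set (ℝ × ℝ)) (u : (ℝ × ℝ) → ℝ) : Prop :=
  ContDiff ℝ (⊤ : ℕ∞) u ∧ HasCompactSupport u ∧ tsupport u ⊆ Ω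

noncomputable def Jfun (Ω : Set (ℝ × ℝ)) (a₁ a₂ b₁ b₂ θ₁ θ₂ lam : ℝ)
    (H : (ℝ × ℝ) → (ℝ × ℝ) → ℝ) (u v : (ℝ × ℝ) → ℝ) : ℝ :=
  (1/2) * (a₁ * (gnorm Ω u) ^ 2 + (b₁/θ₁) * (gnorm Ω u) ^ (2*θ₁))
  + (1/2) * (a₂ * (gnorm Ω v) ^ 2 + (b₂/θ₂) * (gnorm Ω v) ^ (2*θ₂))
  - lam * ∫ x in Ω, H x (u x, v x)

/-- If `P` and `I` are nondecreasing on `[0, ∞)` and vanish at `0`, `P` is right-continuous at `0`,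
`I` is positive on `(0, ∞)` and every positive multiple of `I` eventually dominates `P`, then
`sup_{t ≥ 0} (P t - lam * I t)` is finite, nonnegative, and tends to `0` as `lam → ∞`. -/
theorem sSup_sub_mul_tendsto_zero {P I : ℝ → ℝ} (hP : MonotoneOn P (Set.Ici 0)) (hP0 : P 0 = 0)
    (hPc : ContinuousWithinAt P (Set.Ici 0) 0) (hI : MonotoneOn I (Set.Ici 0)) (hI0 : I 0 = 0)
    (hIpos : ∀ t > 0, 0 < I t) (hdom : ∀ lam > 0, ∀ᶠ t in atTop, P t ≤ lam * I t) :
    (∀ lam > (0 : ℝ), BddAbove ((fun t => P t - lam * I t) '' Set.Ici 0) ∧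
      0 ≤ sSup ((fun t => P t - lam * I t) '' Set.Ici 0)) ∧
    Tendsto (fun lam : ℝ => sSup ((fun t => P t - lam * I t) '' Set.Ici 0)) atTop (nhds 0) := by
  have hInn : ∀ t, 0 ≤ t → 0 ≤ I t := fun t ht => hI0 ▸ hI (Set.mem_Ici.2 le_rfl) ht ht
  have hPnn : ∀ t, 0 ≤ t → 0 ≤ P t := fun t ht => hP0 ▸ hP (Set.mem_Ici.2 le_rfl) ht ht
  have hbdd : ∀ lam > (0 : ℝ), BddAbove ((fun t => P t - lam * I t) '' Set.Ici 0) := by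
    intro lam hlam
    obtain ⟨T, hT⟩ := eventually_atTop.1 (hdom lam hlam)
    refine ⟨P (max T 0), ?_⟩
    rintro _ ⟨t, ht, rfl⟩
    rw [Set.mem_Ici] at ht
    have h0 : (0 : ℝ) ≤ max T 0 := le_max_right _ _
    rcases le_total t (max T 0) with h | h
    · have := hP ht h0 h
      have := mul_nonneg hlam.le (hInn t ht)
      dsimp only
      linarith
    · have := hT t ((le_max_left _ _).trans h)
      have := hPnn _ h0
      dsimp only
      linarith
  have hnonneg : ∀ lam > (0 : ℝ), 0 ≤ sSup ((fun t => P t - lam * I t) '' Set.Ici 0) :=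
    fun lam hlam => le_csSup (hbdd lam hlam) ⟨0, Set.mem_Ici.2 le_rfl, by simp [hP0, hI0]⟩
  refine ⟨fun lam hlam => ⟨hbdd lam hlam, hnonneg lam hlam⟩, ?_⟩
  rw [Metric.tendsto_atTop]
  intro ε hε
  obtain ⟨δ, hδ, hδP⟩ : ∃ δ > 0, P δ < ε := by
    have h1 : ∀ᶠ t in nhdsWithin (0 : ℝ) (Set.Ioi 0), P t < ε := by
      have h2 : ∀ᶠ t in nhdsWithin (0 : ℝ) (Set.Ici 0), P t < ε :=
        hPc.eventually_lt continuousWithinAt_const (by rwa [hP0])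
      exact h2.filter_mono (nhdsWithin_mono _ Set.Ioi_subset_Ici_self)
    obtain ⟨δ, h, h'⟩ := (h1.and self_mem_nhdsWithin).exists
    exact ⟨δ, h', h⟩
  obtain ⟨T, hT⟩ := eventually_atTop.1 (hdom 1 one_pos)
  refine ⟨max 1 (P (max T 0) / I δ), fun lam hlam => ?_⟩
  have h1 : 1 ≤ lam := (le_max_left _ _).trans hlam
  have hl0 : 0 < lam := one_pos.trans_le h1
  have h2 : P (max T 0) ≤ lam * I δ :=
    (div_le_iff₀ (hIpos δ hδ)).1 ((le_max_right _ _).trans hlam)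
  rw [Real.dist_eq, sub_zero, abs_of_nonneg (hnonneg lam hl0)]
  refine lt_of_le_of_lt (csSup_le (Set.Nonempty.image _ ⟨0, Set.mem_Ici.2 le_rfl⟩) ?_) hδP
  rintro _ ⟨t, ht, rfl⟩
  rw [Set.mem_Ici] at ht
  have h0 : (0 : ℝ) ≤ max T 0 := le_max_right _ _
  have hPδ := hPnn δ hδ.le
  have hIt := hInn t ht
  dsimp only
  rcases le_total t δ with h | h
  · have := hP ht hδ.le h
    have := mul_nonneg hl0.le hIt
    linarith
  · rcases le_total t (max T 0) with h' | h'
    · have := hP ht h0 h'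
      have := mul_le_mul_of_nonneg_left (hI hδ.le ht h) hl0.le
      linarith
    · have := hT t ((le_max_left _ _).trans h')
      have := mul_le_mul_of_nonneg_right h1 hIt
      linarith

theorem isLittleO_rpow_rpow_atTop_of_lt {p q : ℝ} (hpq : p < q) :
    Asymptotics.IsLittleO atTop (fun t : ℝ => t ^ p) (fun t => t ^ q) := by
  rw [Asymptotics.isLittleO_iff_tendsto'
    ((eventually_gt_atTop 0).mono fun t ht h => absurd h (Real.rpow_pos_of_pos ht q).ne')]
  refine (tendsto_rpow_neg_atTop (sub_pos.2 hpq)).congr' ?_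
  filter_upwards [eventually_gt_atTop 0] with t ht
  rw [neg_sub, Real.rpow_sub ht]

theorem gnorm_const_mul (Ω : Set (ℝ × ℝ)) {u : (ℝ × ℝ) → ℝ} (hu : Differentiable ℝ u) {t : ℝ}
    (ht : 0 ≤ t) : gnorm Ω (fun x => t * u x) = t * gnorm Ω u := by
  have h : ∀ x, ‖fderiv ℝ (fun x => t * u x) x‖ ^ 2 = t ^ 2 * ‖fderiv ℝ u x‖ ^ 2 := by
    intro x
    rw [fderiv_const_mul (hu x), norm_smul, mul_pow, Real.norm_eq_abs, sq_abs]
  simp only [gnorm, h]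
  rw [integral_const_mul, Real.sqrt_mul (sq_nonneg t), Real.sqrt_sq ht]

/-- A function satisfying the differential inequality `0 ≤ W · ∇h W` is nondecreasing along rays
issuing from the origin. -/
theorem monotoneOn_ray {h hu hv : ℝ × ℝ → ℝ}
    (hderiv : ∀ W, HasFDerivAt h
      (hu W • ContinuousLinearMap.fst ℝ ℝ ℝ + hv W • ContinuousLinearMap.snd ℝ ℝ ℝ) W)
    (hnonneg : ∀ W, 0 ≤ W.1 * hu W + W.2 * hv W) (a b : ℝ) :
    MonotoneOn (fun t : ℝ => h (t * a, t * b)) (Set.Ici 0) := by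
  have hd : ∀ t : ℝ, HasDerivAt (fun t : ℝ => h (t * a, t * b))
      (hu (t * a, t * b) * a + hv (t * a, t * b) * b) t := by
    intro t
    have hray : HasDerivAt (fun t : ℝ => (t * a, t * b)) (a, b) t := by
      simpa using ((hasDerivAt_id t).mul_const a).prodMk ((hasDerivAt_id t).mul_const b)
    simpa [Function.comp_def] using (hderiv (t * a, t * b)).comp_hasDerivAt t hray
  refine monotoneOn_of_deriv_nonneg (convex_Ici 0)
    (fun t _ => (hd t).continuousAt.continuousWithinAt)
    (fun t _ => (hd t).differentiableAt.differentiableWithinAt) fun t ht => ?_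
  rw [interior_Ici, Set.mem_Ioi] at ht
  rw [(hd t).deriv]
  have := hnonneg (t * a, t * b)
  dsimp only at this
  refine nonneg_of_mul_nonneg_right (a := t) ?_ ht
  linarith

/-- A function with continuous gradient at the origin and `m * h W ≤ W · ∇h W` away from the origin,
where `m > 0`, is nonpositive at the origin. -/
theorem apply_zero_nonpos {h hu hv : ℝ × ℝ → ℝ} {m : ℝ} (hm : 0 < m)
    (hc : ContinuousAt h (0, 0)) (hgrad : ContinuousAt (fun W => (hu W, hv W)) (0, 0))
    (hle : ∀ W, W ≠ (0, 0) → m * h W ≤ W.1 * hu W + W.2 * hv W) : h (0, 0) ≤ 0 := by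
  have h1 : ContinuousAt (fun W : ℝ × ℝ => W.1 * hu W + W.2 * hv W) (0, 0) :=
    (continuousAt_fst.mul hgrad.fst).add (continuousAt_snd.mul hgrad.snd)
  have h2 : m * h (0, 0) ≤ (0 : ℝ) * hu (0, 0) + 0 * hv (0, 0) :=
    le_of_tendsto_of_tendsto ((continuousAt_const.mul hc).tendsto.mono_left nhdsWithin_le_nhds)
      (h1.tendsto.mono_left nhdsWithin_le_nhds)
      (eventually_nhdsWithin_of_forall (s := {(0, 0)}ᶜ) fun W hW => hle W hW)
  refine nonpos_of_mul_nonpos_right (a := m) ?_ hm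
  simpa using h2

/-- The integral over `Ω` of a nonnegative function that is positive on a nonempty open subset
is positive. -/
theorem setIntegral_pos_of_pos_on_open {Ω U : Set (ℝ × ℝ)} (hΩ : MeasurableSet Ω)
    {f : ℝ × ℝ → ℝ} (hf : IntegrableOn f Ω) (hnn : ∀ x ∈ Ω, 0 ≤ f x) (hU : IsOpen U)
    (hUne : U.Nonempty) (hUΩ : U ⊆ Ω) (hpos : ∀ x ∈ U, 0 < f x) : 0 < ∫ x in Ω, f x := by
  rw [setIntegral_pos_iff_support_of_nonneg_ae ((ae_restrict_iff' hΩ).2 (.of_forall hnn)) hf]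
  exact (hU.measure_pos volume hUne).trans_le
    (measure_mono fun x hx => ⟨(hpos x hx).ne', hUΩ hx⟩)

/-- Under `(H₃)` and the lower growth bound, for a fixed nonnegative test pair
`Φ = (φ, ψ)` not both identically zero, the quantity `M(λ) = sup_{t ≥ 0} J_λ(tΦ)` is
finite and nonnegative for each `λ > 0`, and `M(λ) → 0` as `λ → +∞`. -/
theorem stmt_9 (Ω : Set (ℝ × ℝ)) (hne : Ω.Nonempty) (hop : IsOpen Ω)
    (hbd : Bornology.IsBounded Ω)
    (a₁ a₂ b₁ b₂ θ₁ θ₂ : ℝ)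
    (ha₁ : 0 < a₁) (ha₂ : 0 < a₂) (hb₁ : 0 < b₁) (hb₂ : 0 < b₂)
    (hθ₁ : 1 < θ₁) (hθ₂ : 1 < θ₂)
    (H Hu Hv : (ℝ × ℝ) → (ℝ × ℝ) → ℝ)
    (hHc : ContinuousOn (fun p : (ℝ × ℝ) × (ℝ × ℝ) => H p.1 p.2) (closure Ω ×ˢ Set.univ))
    (hgradc : ContinuousOn (fun p : (ℝ × ℝ) × (ℝ × ℝ) => (Hu p.1 p.2, Hv p.1 p.2))
      (closure Ω ×ˢ Set.univ))
    (hderiv : ∀ x ∈ closure Ω, ∀ W : ℝ × ℝ,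
      HasFDerivAt (H x)
        ((Hu x W) • ContinuousLinearMap.fst ℝ ℝ ℝ + (Hv x W) • ContinuousLinearMap.snd ℝ ℝ ℝ) W)
    (hHnn : ∀ x ∈ closure Ω, ∀ W : ℝ × ℝ, 0 ≤ H x W)
    -- (H₃)
    (hH3 : ∀ x ∈ closure Ω, ∀ W : ℝ × ℝ, W ≠ (0, 0) →
      0 < 2 * max θ₁ θ₂ * H x W ∧
        2 * max θ₁ θ₂ * H x W ≤ W.1 * Hu x W + W.2 * Hv x W)
    -- lower growth bound
    (ξ C₁ C₂ : ℝ) (hξ : 2 * max θ₁ θ₂ < ξ) (hC₁ : 0 < C₁) (hC₂ : 0 ≤ C₂)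
    (hlow : ∀ x ∈ closure Ω, ∀ W : ℝ × ℝ,
      C₁ * (Real.sqrt (W.1 ^ 2 + W.2 ^ 2)) ^ ξ - C₂ ≤ H x W)
    -- the fixed nonnegative test pair
    (φ ψ : (ℝ × ℝ) → ℝ) (hφ : IsTest Ω φ) (hψ : IsTest Ω ψ)
    (hnn : ∀ x, 0 ≤ φ x ∧ 0 ≤ ψ x)
    (hΦne : φ ≠ (fun _ => 0) ∨ ψ ≠ (fun _ => 0)) :
    (∀ lam > (0 : ℝ),
      BddAbove ((fun t : ℝ =>
          Jfun Ω a₁ a₂ b₁ b₂ θ₁ θ₂ lam H (fun x => t * φ x) (fun x => t * ψ x)) '' Set.Ici 0) ∧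
      0 ≤ sSup ((fun t : ℝ =>
          Jfun Ω a₁ a₂ b₁ b₂ θ₁ θ₂ lam H (fun x => t * φ x) (fun x => t * ψ x)) '' Set.Ici 0)) ∧
    Tendsto (fun lam : ℝ =>
        sSup ((fun t : ℝ =>
          Jfun Ω a₁ a₂ b₁ b₂ θ₁ θ₂ lam H (fun x => t * φ x) (fun x => t * ψ x)) '' Set.Ici 0))
      atTop (nhds 0) := by
  have hm : 0 < 2 * max θ₁ θ₂ := by
    have := le_max_left θ₁ θ₂
    linarith
  have hξ0 : 0 < ξ := hm.trans hξ
  have hφc : Continuous φ := hφ.1.continuous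
  have hψc : Continuous ψ := hψ.1.continuous
  have hφd : Differentiable ℝ φ := hφ.1.differentiable (by simp)
  have hψd : Differentiable ℝ ψ := hψ.1.differentiable (by simp)
  have hcpt : IsCompact (closure Ω) := hbd.isCompact_closure
  have hvol : volume Ω ≠ ⊤ := hbd.measure_lt_top.ne
  have hslice : ∀ x ∈ closure Ω, H x (0, 0) = 0 := by
    intro x hx
    refine le_antisymm (apply_zero_nonpos hm (hderiv x hx _).continuousAt ?_
      fun W hW => (hH3 x hx W hW).2) (hHnn x hx _)
    have : Continuous fun W : ℝ × ℝ => (Hu x W, Hv x W) :=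
      hgradc.comp_continuous (f := fun W : ℝ × ℝ => (x, W)) (by fun_prop)
        fun W => ⟨hx, Set.mem_univ _⟩
    exact this.continuousAt
  have hgrad_nonneg : ∀ x ∈ closure Ω, ∀ W : ℝ × ℝ, 0 ≤ W.1 * Hu x W + W.2 * Hv x W := by
    intro x hx W
    by_cases hW : W = (0, 0)
    · simp [hW]
    · exact (hH3 x hx W hW).1.le.trans (hH3 x hx W hW).2
  have hInt : ∀ t : ℝ, IntegrableOn (fun x => H x (t * φ x, t * ψ x)) Ω := by
    intro t
    have : ContinuousOn (fun x => H x (t * φ x, t * ψ x)) (closure Ω) :=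
      hHc.comp (f := fun x => (x, (t * φ x, t * ψ x))) (by fun_prop)
        fun x hx => ⟨hx, Set.mem_univ _⟩
    exact (this.integrableOn_compact hcpt).mono_set subset_closure
  set U : Set (ℝ × ℝ) := {x | φ x ≠ 0} ∪ {x | ψ x ≠ 0}
  have hUo : IsOpen U :=
    (isOpen_ne_fun hφc continuous_const).union (isOpen_ne_fun hψc continuous_const)
  have hUne : U.Nonempty := by
    rcases hΦne with h | h <;> obtain ⟨x, hx⟩ := Function.ne_iff.1 h
    · exact ⟨x, Or.inl hx⟩
    · exact ⟨x, Or.inr hx⟩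
  have hUΩ : U ⊆ Ω := by
    rintro x (hx | hx)
    · exact hφ.2.2 (subset_tsupport _ hx)
    · exact hψ.2.2 (subset_tsupport _ hx)
  set N : ℝ × ℝ → ℝ := fun x => Real.sqrt (φ x ^ 2 + ψ x ^ 2)
  have hNint : IntegrableOn (fun x => N x ^ ξ) Ω := by
    have : Continuous fun x => N x ^ ξ :=
      Continuous.rpow_const (by fun_prop) fun x => Or.inr hξ0.le
    exact (this.continuousOn.integrableOn_compact hcpt).mono_set subset_closure
  set K : ℝ := ∫ x in Ω, N x ^ ξ
  have hK : 0 < K := by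
    refine setIntegral_pos_of_pos_on_open hop.measurableSet hNint
      (fun x _ => Real.rpow_nonneg (Real.sqrt_nonneg _) _) hUo hUne hUΩ fun x hx => ?_
    refine Real.rpow_pos_of_pos (Real.sqrt_pos.2 ?_) _
    rcases hx with hx | hx
    · have : φ x ≠ 0 := hx
      positivity
    · have : ψ x ≠ 0 := hx
      positivity
  set I : ℝ → ℝ := fun t => ∫ x in Ω, H x (t * φ x, t * ψ x) with hIdef
  have hIlow : ∀ t, 0 ≤ t → C₁ * K * t ^ ξ - C₂ * volume.real Ω ≤ I t := by
    intro t ht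
    have hle : ∫ x in Ω, (C₁ * t ^ ξ * N x ^ ξ - C₂) ≤ I t := by
      refine setIntegral_mono_on ((hNint.const_mul _).sub (integrableOn_const hvol)) (hInt t)
        hop.measurableSet fun x hx => ?_
      have h := hlow x (subset_closure hx) (t * φ x, t * ψ x)
      have hs : Real.sqrt ((t * φ x) ^ 2 + (t * ψ x) ^ 2) = t * N x := by
        rw [show (t * φ x) ^ 2 + (t * ψ x) ^ 2 = t ^ 2 * (φ x ^ 2 + ψ x ^ 2) by ring,
          Real.sqrt_mul (sq_nonneg t), Real.sqrt_sq ht]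
      dsimp only at h
      rw [hs, Real.mul_rpow ht (Real.sqrt_nonneg _)] at h
      linarith
    rw [integral_sub (hNint.const_mul _) (integrableOn_const hvol), integral_const_mul,
      setIntegral_const, smul_eq_mul] at hle
    linarith
  set A : ℝ := (1 / 2) * (a₁ * gnorm Ω φ ^ 2 + a₂ * gnorm Ω ψ ^ 2) with hA
  set B₁ : ℝ := (1 / 2) * (b₁ / θ₁ * gnorm Ω φ ^ (2 * θ₁)) with hB₁
  set B₂ : ℝ := (1 / 2) * (b₂ / θ₂ * gnorm Ω ψ ^ (2 * θ₂)) with hB₂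
  have hg1 : 0 ≤ gnorm Ω φ := Real.sqrt_nonneg _
  have hg2 : 0 ≤ gnorm Ω ψ := Real.sqrt_nonneg _
  have hA0 : 0 ≤ A := by positivity
  have hB10 : 0 ≤ B₁ := by positivity
  have hB20 : 0 ≤ B₂ := by positivity
  set P : ℝ → ℝ := fun t => A * t ^ (2 : ℝ) + B₁ * t ^ (2 * θ₁) + B₂ * t ^ (2 * θ₂) with hPdef
  have himage : ∀ lam : ℝ, (fun t : ℝ =>
      Jfun Ω a₁ a₂ b₁ b₂ θ₁ θ₂ lam H (fun x => t * φ x) (fun x => t * ψ x)) '' Set.Ici 0 =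
      (fun t => P t - lam * I t) '' Set.Ici 0 := by
    intro lam
    refine Set.image_congr fun t ht => ?_
    rw [Set.mem_Ici] at ht
    simp only [Jfun, hPdef, hIdef, hA, hB₁, hB₂, gnorm_const_mul Ω hφd ht,
      gnorm_const_mul Ω hψd ht, Real.mul_rpow ht hg1, Real.mul_rpow ht hg2, Real.rpow_two]
    ring
  simp only [himage]
  have hPcont : Continuous P := by
    have h : ∀ p : ℝ, 0 ≤ p → Continuous fun t : ℝ => t ^ p := fun p hp =>
      continuous_id.rpow_const fun _ => Or.inr hp
    have := h 2 (by norm_num)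
    have := h (2 * θ₁) (by linarith)
    have := h (2 * θ₂) (by linarith)
    fun_prop
  refine sSup_sub_mul_tendsto_zero ?_ ?_ hPcont.continuousWithinAt ?_ ?_ ?_ ?_
  · intro s hs t ht hst
    rw [Set.mem_Ici] at hs
    simp only [hPdef]
    gcongr
  · simp only [hPdef]
    rw [Real.zero_rpow (by norm_num), Real.zero_rpow (by linarith), Real.zero_rpow (by linarith)]
    ring
  · intro s hs t ht hst
    exact setIntegral_mono_on (hInt s) (hInt t) hop.measurableSet fun x hx =>
      monotoneOn_ray (hderiv x (subset_closure hx)) (hgrad_nonneg x (subset_closure hx))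
        (φ x) (ψ x) hs ht hst
  · simp only [hIdef, zero_mul]
    exact setIntegral_eq_zero_of_forall_eq_zero fun x hx => hslice x (subset_closure hx)
  · intro t ht
    refine setIntegral_pos_of_pos_on_open hop.measurableSet (hInt t)
      (fun x hx => hHnn x (subset_closure hx) _) hUo hUne hUΩ fun x hx => ?_
    refine pos_of_mul_pos_right (hH3 x (subset_closure (hUΩ hx)) _ fun h => ?_).1 hm.le
    have h1 := congrArg Prod.fst h
    have h2 := congrArg Prod.snd h
    simp only [mul_eq_zero, ht.ne', false_or] at h1 h2
    exact hx.elim (fun h => h h1) (fun h => h h2)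
  · intro lam hlam
    have hpow : ∀ p < ξ, Asymptotics.IsLittleO atTop (fun t : ℝ => t ^ p) (fun t => t ^ ξ) := fun p hp =>
      isLittleO_rpow_rpow_atTop_of_lt hp
    have hθ1 := le_max_left θ₁ θ₂
    have hθ2 := le_max_right θ₁ θ₂
    have hconst : Asymptotics.IsLittleO atTop (fun _ : ℝ => lam * (C₂ * volume.real Ω))
        (fun t : ℝ => t ^ ξ) := by
      simpa using (hpow 0 hξ0).const_mul_left (lam * (C₂ * volume.real Ω))
    have hlittle := ((((hpow 2 (by linarith)).const_mul_left A).add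
      ((hpow (2 * θ₁) (by linarith)).const_mul_left B₁)).add
      ((hpow (2 * θ₂) (by linarith)).const_mul_left B₂)).add hconst
    filter_upwards [hlittle.bound (show 0 < lam * (C₁ * K) by positivity), eventually_ge_atTop 0]
      with t h ht
    rw [Real.norm_of_nonneg (Real.rpow_nonneg ht ξ)] at h
    have h1 := (le_abs_self _).trans h
    have h2 := mul_le_mul_of_nonneg_left (hIlow t ht) hlam.le
    simp only [hPdef]
    linarith
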